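/- (Local consistency of the nonuniform Alikhanov formula.) Let 0 < α < 1, θ := α/2, σ ∈ (0,1) ∪ (1,2), and let v ∈ C³_σ((0,T]). Let 0 = t_0 < ⋯ < t_N = T be a mesh whose step ratios satisfy ρ_k ≤ 7/4 for all k. Define the local consistency error Υ^{n−θ}[v] := (∂_t^α v)(t_{n−θ}) − Σ_{k=1}^n A^{(n,θ)}_{n−k} (v(t_k) − v(t_{k−1})). Then for every 1 ≤ n ≤ N: |Υ^{n−θ}[v]| ≤ A^{(n,θ)}_0 G_loc^n + Σ_{k=1}^{n−1} (A^{(n,θ)}_{n−k−1} − A^{(n,θ)}_{n−k}) G_his^k, where G_loc^k := (3/2) ∫_{t_{k−1}}^{t_{k−1/2}} (s − t_{k−1})² |v'''(s)| ds + (3τ_k/2) ∫_{t_{k−1/2}}^{t_k} (t_k − s) |v'''(s)| ds and G_his^k := (5/2) ∫_{t_{k−1}}^{t_k} (s − t_{k−1})² |v'''(s)| ds + (5/2) ∫_{t_k}^{t_{k+1}} (t_{k+1} − s)² |v'''(s)| ds. -/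

import Mathlib

/-- `ω_β(x) = x^(β-1)/Γ(β)`. -/
noncomputable def om (β x : ℝ) : ℝ := x ^ (β - 1) / Real.Gamma β

/-- Weighted time point `t_{n-θ} := θ t_{n-1} + (1-θ) t_n`. -/
noncomputable def tw (θ : ℝ) (t : ℕ → ℝ) (n : ℕ) : ℝ := θ * t (n-1) + (1-θ) * t n

/-- Step ratio `ρ_k = τ_k / τ_{k+1}`. -/
noncomputable def rhok (t : ℕ → ℝ) (k : ℕ) : ℝ := (t k - t (k-1)) / (t (k+1) - t k)

/-- Alikhanov coefficient `a^{(n)}_{n-k}` (with `a^{(n)}_0` given by the `k = n` case). -/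
noncomputable def aco (α : ℝ) (t : ℕ → ℝ) (n k : ℕ) : ℝ :=
  if k = n then
    (1 / (t n - t (n-1))) *
      ∫ s in (t (n-1))..(tw (α/2) t n), (tw (α/2) t n - s) ^ (-α) / Real.Gamma (1-α)
  else
    (1 / (t k - t (k-1))) *
      ∫ s in (t (k-1))..(t k), (tw (α/2) t n - s) ^ (-α) / Real.Gamma (1-α)

/-- Alikhanov coefficient `b^{(n)}_{n-k}` for `1 ≤ k ≤ n-1`. -/
noncomputable def bco (α : ℝ) (t : ℕ → ℝ) (n k : ℕ) : ℝ :=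
  (2 / ((t k - t (k-1)) * ((t k - t (k-1)) + (t (k+1) - t k)))) *
    ∫ s in (t (k-1))..(t k),
      (s - (t (k-1) + t k)/2) * ((tw (α/2) t n - s) ^ (-α) / Real.Gamma (1-α))

/-- Alikhanov discrete kernel `AK α t n k = A^{(n,θ)}_{n-k}` with `θ = α/2`. -/
noncomputable def AK (α : ℝ) (t : ℕ → ℝ) (n k : ℕ) : ℝ :=
  if n ≤ 1 then aco α t n n
  else if k = n then aco α t n n + rhok t (n-1) * bco α t n (n-1)
  else if k = 1 then aco α t n 1 - bco α t n 1
  else aco α t n k + rhok t (k-1) * bco α t n (k-1) - bco α t n k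

/-- Caputo fractional derivative of order α, expressed through the first derivative. -/
noncomputable def caputo (α : ℝ) (v' : ℝ → ℝ) (x : ℝ) : ℝ :=
  ∫ s in (0:ℝ)..x, ((x - s) ^ (-α) / Real.Gamma (1 - α)) * v' s

/-- `G_loc^k` for the Alikhanov consistency analysis. -/
noncomputable def Gloc (v3 : ℝ → ℝ) (t : ℕ → ℝ) (k : ℕ) : ℝ :=
  (3/2) * (∫ s in (t (k-1))..((t (k-1) + t k)/2), (s - t (k-1))^2 * |v3 s|)
    + (3 * (t k - t (k-1)) / 2) * ∫ s in ((t (k-1) + t k)/2)..(t k), (t k - s) * |v3 s|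

/-- `G_his^k` for the Alikhanov consistency analysis. -/
noncomputable def Ghis (v3 : ℝ → ℝ) (t : ℕ → ℝ) (k : ℕ) : ℝ :=
  (5/2) * (∫ s in (t (k-1))..(t k), (s - t (k-1))^2 * |v3 s|)
    + (5/2) * ∫ s in (t k)..(t (k+1)), (t (k+1) - s)^2 * |v3 s|

open MeasureTheory Set Filter Topology intervalIntegral

def Reg (T C β : ℝ) (v p q z : ℝ → ℝ) : Prop :=
  0 ≤ C ∧ 0 < β ∧ β < 1 ∧ ContinuousOn v (Set.Icc 0 T) ∧
  (∀ s ∈ Set.Ioc (0:ℝ) T, HasDerivAt v (p s) s) ∧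
  (∀ s ∈ Set.Ioc (0:ℝ) T, HasDerivAt p (q s) s) ∧
  (∀ s ∈ Set.Ioc (0:ℝ) T, HasDerivAt q (z s) s) ∧
  (∀ s ∈ Set.Ioc (0:ℝ) T, |p s| ≤ C * s ^ (β - 1)) ∧
  (∀ s ∈ Set.Ioc (0:ℝ) T, |q s| ≤ C * s ^ (β - 2)) ∧
  (∀ s ∈ Set.Ioc (0:ℝ) T, |z s| ≤ C * s ^ (β - 3))

lemma reg_aux (T Cv σ j : ℝ) (hσ0 : 0 < σ) (hj : 1 ≤ j) (hσ2 : σ < 2) (hCv : 0 < Cv) (hT : 0 < T) :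
    ∃ C : ℝ, 0 ≤ C ∧ ∀ s ∈ Set.Ioc (0:ℝ) T, Cv * (1 + s ^ (σ - j)) ≤ C * s ^ (σ/2 - j) := by
  refine ⟨Cv * (T ^ (j - σ/2) + T ^ (σ/2)), by positivity, ?_⟩
  rintro s ⟨h0, h1⟩
  have e1 : s ^ (σ - j) = s ^ (σ/2) * s ^ (σ/2 - j) := by
    rw [← Real.rpow_add h0]; ring_nf
  have e2 : (1:ℝ) = s ^ (j - σ/2) * s ^ (σ/2 - j) := by
    rw [← Real.rpow_add h0]; ring_nf; simp
  have h3 : s ^ (σ/2) ≤ T ^ (σ/2) := Real.rpow_le_rpow h0.le h1 (by linarith)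
  have h4 : s ^ (j - σ/2) ≤ T ^ (j - σ/2) := Real.rpow_le_rpow h0.le h1 (by linarith)
  have h5 : 0 < s ^ (σ/2 - j) := Real.rpow_pos_of_pos h0 _
  rw [mul_assoc]
  apply mul_le_mul_of_nonneg_left _ hCv.le
  rw [add_mul]
  calc 1 + s ^ (σ - j) = s ^ (j - σ/2) * s ^ (σ/2 - j) + s ^ (σ/2) * s ^ (σ/2 - j) := by
        rw [← e2, ← e1]
    _ ≤ _ := by gcongr

lemma mkReg (σ T Cv : ℝ) 
    (hσ : (0 < σ ∧ σ < 1) ∨ (1 < σ ∧ σ < 2)) (hT : 0 < T) (hCv : 0 < Cv)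
    (v v' v'' v''' : ℝ → ℝ)
    (hvc : ContinuousOn v (Set.Icc 0 T))
    (hd1 : ∀ s ∈ Set.Ioc (0:ℝ) T, HasDerivAt v (v' s) s)
    (hd2 : ∀ s ∈ Set.Ioc (0:ℝ) T, HasDerivAt v' (v'' s) s)
    (hd3 : ∀ s ∈ Set.Ioc (0:ℝ) T, HasDerivAt v'' (v''' s) s)
    (hb1 : ∀ s ∈ Set.Ioc (0:ℝ) T, |v' s| ≤ Cv * (1 + s ^ (σ - 1)))
    (hb2 : ∀ s ∈ Set.Ioc (0:ℝ) T, |v'' s| ≤ Cv * (1 + s ^ (σ - 2)))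
    (hb3 : ∀ s ∈ Set.Ioc (0:ℝ) T, |v''' s| ≤ Cv * (1 + s ^ (σ - 3))) :
    ∃ C β, Reg T C β v v' v'' v''' := by
  have h0 : 0 < σ := by rcases hσ with h | h <;> linarith
  have h2 : σ < 2 := by rcases hσ with h | h <;> linarith
  obtain ⟨C1, hC1, H1⟩ := reg_aux T Cv σ 1 h0 (by norm_num) h2 hCv hT
  obtain ⟨C2, hC2, H2⟩ := reg_aux T Cv σ 2 h0 (by norm_num) h2 hCv hT
  obtain ⟨C3, hC3, H3⟩ := reg_aux T Cv σ 3 h0 (by norm_num) h2 hCv hT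
  have key : ∀ j Cj : ℝ, Cj ≤ C1 + C2 + C3 → ∀ s ∈ Set.Ioc (0:ℝ) T,
      Cj * s ^ (σ/2 - j) ≤ (C1 + C2 + C3) * s ^ (σ/2 - j) := by
    intro j Cj h s hs
    exact mul_le_mul_of_nonneg_right h (Real.rpow_nonneg hs.1.le _)
  refine ⟨C1 + C2 + C3, σ/2, by positivity, by linarith, by linarith, hvc, hd1, hd2, hd3, ?_, ?_, ?_⟩
  · intro s hs
    exact (hb1 s hs).trans ((H1 s hs).trans (key _ _ (by linarith) s hs))
  · intro s hs
    exact (hb2 s hs).trans ((H2 s hs).trans (key _ _ (by linarith) s hs))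
  · intro s hs
    exact (hb3 s hs).trans ((H3 s hs).trans (key _ _ (by linarith) s hs))

section
variable {T C β : ℝ} {v p q z : ℝ → ℝ}

lemma Reg.contP (H : Reg T C β v p q z) : ContinuousOn p (Ioc 0 T) :=
  fun s hs => (H.2.2.2.2.2.1 s hs).continuousAt.continuousWithinAt
lemma Reg.contQ (H : Reg T C β v p q z) : ContinuousOn q (Ioc 0 T) :=
  fun s hs => (H.2.2.2.2.2.2.1 s hs).continuousAt.continuousWithinAt

lemma Reg.measZ (H : Reg T C β v p q z) :
    AEStronglyMeasurable z (volume.restrict (Ioc 0 T)) := by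
  refine (measurable_deriv q).aestronglyMeasurable.congr ?_
  filter_upwards [ae_restrict_mem measurableSet_Ioc] with s hs
  exact (H.2.2.2.2.2.2.1 s hs).deriv

lemma Reg.intP0 (H : Reg T C β v p q z) (hT : 0 ≤ T) : IntervalIntegrable p volume 0 T := by
  have h1 : IntervalIntegrable (fun s : ℝ => C * s ^ (β - 1)) volume 0 T :=
    (intervalIntegrable_rpow' (by linarith [H.2.1])).const_mul C
  rw [intervalIntegrable_iff_integrableOn_Ioc_of_le hT] at h1 ⊢
  refine Integrable.mono' h1 (H.contP.aestronglyMeasurable measurableSet_Ioc) ?_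
  filter_upwards [ae_restrict_mem measurableSet_Ioc] with s hs
  exact H.2.2.2.2.2.2.2.1 s hs

lemma Reg.intP (H : Reg T C β v p q z) {a b : ℝ} (ha : 0 ≤ a) (hab : a ≤ b) (hb : b ≤ T) :
    IntervalIntegrable p volume a b := by
  refine (H.intP0 (by linarith)).mono_set ?_
  rw [uIcc_of_le hab, uIcc_of_le (by linarith)]
  exact Icc_subset_Icc ha hb

lemma Reg.intZ2 (H : Reg T C β v p q z) (hT : 0 ≤ T) :
    IntervalIntegrable (fun s => s ^ 2 * |z s|) volume 0 T := by
  have h1 : IntervalIntegrable (fun s : ℝ => C * s ^ (β - 1)) volume 0 T :=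
    (intervalIntegrable_rpow' (by linarith [H.2.1])).const_mul C
  rw [intervalIntegrable_iff_integrableOn_Ioc_of_le hT] at h1 ⊢
  refine Integrable.mono' h1 ?_ ?_
  · exact (continuous_pow 2).aestronglyMeasurable.mul H.measZ.norm
  filter_upwards [ae_restrict_mem measurableSet_Ioc] with s hs
  have := H.2.2.2.2.2.2.2.2.2 s hs
  have e : s ^ (β - 1) = s ^ 2 * s ^ (β - 3) := by
    rw [← Real.rpow_natCast s 2, ← Real.rpow_add hs.1]; congr 1; push_cast; ring
  rw [Real.norm_of_nonneg (by positivity), e]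
  nlinarith [sq_nonneg s]

lemma Reg.intKz (H : Reg T C β v p q z) {a b M : ℝ} (ha : 0 ≤ a) (hab : a ≤ b) (hb : b ≤ T)
    {K : ℝ → ℝ} (hK : ContinuousOn K (Icc a b)) (hM : ∀ s ∈ Icc a b, |K s| ≤ M * s ^ 2) :
    IntervalIntegrable (fun s => K s * z s) volume a b := by
  have h1 : IntervalIntegrable (fun s => M * (s ^ 2 * |z s|)) volume a b := by
    refine ((H.intZ2 (by linarith)).const_mul M).mono_set ?_
    rw [uIcc_of_le hab, uIcc_of_le (by linarith)]
    exact Icc_subset_Icc ha hb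
  rw [intervalIntegrable_iff_integrableOn_Ioc_of_le hab] at h1 ⊢
  refine Integrable.mono' h1 ?_ ?_
  · exact ((hK.mono Ioc_subset_Icc_self).aestronglyMeasurable measurableSet_Ioc).mul
      (H.measZ.mono_measure (Measure.restrict_mono (Ioc_subset_Ioc ha hb) le_rfl))
  filter_upwards [ae_restrict_mem measurableSet_Ioc] with s hs
  rw [Real.norm_eq_abs, abs_mul, ← mul_assoc]
  exact mul_le_mul_of_nonneg_right (hM s ⟨hs.1.le, hs.2⟩) (abs_nonneg _)

lemma Reg.intKz_pos (H : Reg T C β v p q z) {a b : ℝ} (ha : 0 < a) (hab : a ≤ b) (hb : b ≤ T)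
    {K : ℝ → ℝ} (hK : ContinuousOn K (Icc a b)) :
    IntervalIntegrable (fun s => K s * z s) volume a b := by
  obtain ⟨M, hM⟩ := isCompact_Icc.exists_bound_of_continuousOn hK
  refine H.intKz (M := M / a ^ 2) ha.le hab hb hK ?_
  intro s hs
  have h1 := hM s hs
  rw [Real.norm_eq_abs] at h1
  have h0 : 0 ≤ M := (abs_nonneg _).trans h1
  have : a ^ 2 ≤ s ^ 2 := by nlinarith [hs.1]
  calc |K s| ≤ M := h1
    _ = M / a ^ 2 * a ^ 2 := by field_simp
    _ ≤ _ := by gcongr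

lemma int_abs {K z : ℝ → ℝ} {a b : ℝ} (hab : a ≤ b) (h : IntervalIntegrable (fun s => K s * z s) volume a b)
    (hK : ∀ s ∈ Icc a b, 0 ≤ K s) :
    IntervalIntegrable (fun s => K s * |z s|) volume a b := by
  refine h.norm.congr ?_
  intro s hs
  rw [uIoc_of_le hab] at hs
  simp only [Real.norm_eq_abs, abs_mul]
  rw [abs_of_nonneg (hK s ⟨hs.1.le, hs.2⟩)]

/-- left Peano formula -/
lemma Reg.left (H : Reg T C β v p q z) {a b m M : ℝ} (ha : 0 ≤ a) (hab : a < b) (hb : b ≤ T)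
    {w0 : ℝ → ℝ} (hw0 : ContinuousOn w0 (Icc a b)) (hm0 : 0 ≤ m)
    (hm : ∀ s ∈ Icc a b, m ≤ w0 s) (hM : ∀ s ∈ Icc a b, w0 s ≤ M) :
    ∃ K : ℝ → ℝ, Continuous K ∧ (∀ y ∈ Icc a b, m * (y - a) ^ 2 / 2 ≤ K y) ∧
      (∀ y ∈ Icc a b, K y ≤ M * (y - a) ^ 2 / 2) ∧
      IntervalIntegrable (fun s => K s * z s) volume a b ∧
      ∫ s in a..b, w0 s * (p s - p b - (s - b) * q b) = ∫ s in a..b, K s * z s := by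
  have hM0 : 0 ≤ M := hm0.trans ((hm a ⟨le_rfl, hab.le⟩).trans (hM a ⟨le_rfl, hab.le⟩))
  set w : ℝ → ℝ := IccExtend hab.le ((Icc a b).domRestrict w0) with hwdef
  have hw : Continuous w := (continuousOn_iff_continuous_domRestrict.1 hw0).Icc_extend'
  have hww : ∀ s ∈ Icc a b, w s = w0 s := by
    intro s hs; rw [hwdef, IccExtend_of_mem _ _ hs]; rfl
  set W : ℝ → ℝ := fun y => ∫ s in a..y, w s with hWdef
  have hWd : ∀ y, HasDerivAt W (w y) y := fun y =>
    integral_hasDerivAt_right (hw.intervalIntegrable _ _) (hw.stronglyMeasurableAtFilter _ _) hw.continuousAt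
  have hWc : Continuous W := continuous_iff_continuousAt.2 fun y => (hWd y).continuousAt
  set K : ℝ → ℝ := fun y => ∫ s in a..y, W s with hKdef
  have hKd : ∀ y, HasDerivAt K (W y) y := fun y =>
    integral_hasDerivAt_right (hWc.intervalIntegrable _ _) (hWc.stronglyMeasurableAtFilter _ _) hWc.continuousAt
  have hKc : Continuous K := continuous_iff_continuousAt.2 fun y => (hKd y).continuousAt
  have hWl : ∀ y ∈ Icc a b, m * (y - a) ≤ W y := by
    intro y hy
    have : ∫ s in a..y, m ≤ W y := by
      apply integral_mono_on hy.1 (by simp) (hw.intervalIntegrable _ _)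
      intro s hs; rw [hww s ⟨hs.1, hs.2.trans hy.2⟩]; exact hm s ⟨hs.1, hs.2.trans hy.2⟩
    simpa [mul_comm] using this
  have hWu : ∀ y ∈ Icc a b, W y ≤ M * (y - a) := by
    intro y hy
    have : W y ≤ ∫ s in a..y, M := by
      apply integral_mono_on hy.1 (hw.intervalIntegrable _ _) (by simp)
      intro s hs; rw [hww s ⟨hs.1, hs.2.trans hy.2⟩]; exact hM s ⟨hs.1, hs.2.trans hy.2⟩
    simpa [mul_comm] using this
  have hpoly : ∀ m y : ℝ, ∫ s in a..y, m * (s - a) = m * (y - a) ^ 2 / 2 := by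
    intro m y
    rw [intervalIntegral.integral_const_mul]
    simp [intervalIntegral.integral_comp_sub_right (fun x => x) a, mul_div_assoc]
  have hKl : ∀ y ∈ Icc a b, m * (y - a) ^ 2 / 2 ≤ K y := by
    intro y hy
    rw [← hpoly]
    apply integral_mono_on hy.1 (Continuous.intervalIntegrable (by fun_prop) _ _) (hWc.intervalIntegrable _ _)
    intro s hs; exact hWl s ⟨hs.1, hs.2.trans hy.2⟩
  have hKu : ∀ y ∈ Icc a b, K y ≤ M * (y - a) ^ 2 / 2 := by
    intro y hy
    rw [← hpoly]
    apply integral_mono_on hy.1 (hWc.intervalIntegrable _ _) (Continuous.intervalIntegrable (by fun_prop) _ _)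
    intro s hs; exact hWu s ⟨hs.1, hs.2.trans hy.2⟩
  have hKz : IntervalIntegrable (fun s => K s * z s) volume a b := by
    refine H.intKz (M := M / 2) ha hab.le hb hKc.continuousOn ?_
    intro s hs
    have h1 := hKl s hs
    have h2 := hKu s hs
    have h3 : 0 ≤ m * (s - a) ^ 2 / 2 := by positivity
    rw [abs_of_nonneg (by linarith)]
    have : (s - a) ^ 2 ≤ s ^ 2 := by nlinarith [hs.1]
    nlinarith
  refine ⟨K, hKc, hKl, hKu, hKz, ?_⟩
  have e1 : ∫ s in a..b, w0 s * (p s - p b - (s - b) * q b) =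
      ∫ s in a..b, w s * (p s - p b - (s - b) * q b) := by
    apply intervalIntegral.integral_congr
    intro s hs
    rw [uIcc_of_le hab.le] at hs
    simp only [hww s hs]
  rw [e1]
  have hwr : IntervalIntegrable (fun s => w s * (p s - p b - (s - b) * q b)) volume a b := by
    refine IntervalIntegrable.continuousOn_mul ?_ hw.continuousOn
    exact ((H.intP ha hab.le hb).sub (by simp)).sub (Continuous.intervalIntegrable (by fun_prop) _ _)
  rw [← sub_eq_zero, ← intervalIntegral.integral_sub hwr hKz]
  have hsub : ∀ s ∈ Ioc a b, s ∈ Ioc 0 T := fun s hs => ⟨by linarith [hs.1], by linarith [hs.2]⟩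
  have hbT : b ∈ Ioc 0 T := hsub b ⟨hab, le_rfl⟩
  set F : ℝ → ℝ := fun s => W s * (p s - p b - (s - b) * q b) - K s * (q s - q b) with hF
  have hFd : ∀ s ∈ Ioc a b, HasDerivAt F (w s * (p s - p b - (s - b) * q b) - K s * z s) s := by
    intro s hs
    have hp := H.2.2.2.2.2.1 s (hsub s hs)
    have hq := H.2.2.2.2.2.2.1 s (hsub s hs)
    have h1 := ((hWd s).mul ((hp.sub_const (p b)).sub (((hasDerivAt_id s).sub_const b).mul_const (q b)))).sub
      ((hKd s).mul (hq.sub_const (q b)))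
    refine (h1.congr_deriv ?_)
    simp; ring
  have hFb : Tendsto F (𝓝[<] b) (𝓝 0) := by
    have : F b = 0 := by simp [hF]
    rw [← this]
    exact (hFd b ⟨hab, le_rfl⟩).continuousAt.tendsto.mono_left nhdsWithin_le_nhds
  have hFa : Tendsto F (𝓝[>] a) (𝓝 0) := by
    set G : ℝ → ℝ := fun s => M * (C * (s - a) ^ β + (s - a) * (|p b| + (b - a) * |q b|)) + 
      M * (C * (s - a) ^ β + (s - a) ^ 2 * |q b|) with hG
    have hGt : Tendsto G (𝓝[>] a) (𝓝 0) := by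
      have hc : ContinuousAt G a := by
        have : ContinuousAt (fun s : ℝ => (s - a) ^ β) a :=
          ContinuousAt.rpow_const (by fun_prop) (Or.inr H.2.1.le)
        fun_prop
      have : G a = 0 := by simp [hG, Real.zero_rpow H.2.1.ne']
      rw [← this]
      exact hc.tendsto.mono_left nhdsWithin_le_nhds
    refine squeeze_zero_norm' ?_ hGt
    filter_upwards [Ioo_mem_nhdsGT hab] with s hs
    have hsI : s ∈ Icc a b := ⟨hs.1.le, hs.2.le⟩
    have hsT := hsub s ⟨hs.1, hs.2.le⟩
    have hu : 0 < s - a := by linarith [hs.1]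
    have hp : |p s| ≤ C * (s - a) ^ (β - 1) := (H.2.2.2.2.2.2.2.1 s hsT).trans
      (mul_le_mul_of_nonneg_left (Real.rpow_le_rpow_of_nonpos hu (by linarith) (by linarith [H.2.2.1])) H.1)
    have hq : |q s| ≤ C * (s - a) ^ (β - 2) := (H.2.2.2.2.2.2.2.2.1 s hsT).trans
      (mul_le_mul_of_nonneg_left (Real.rpow_le_rpow_of_nonpos hu (by linarith) (by linarith [H.2.2.1])) H.1)
    have ep : (s - a) ^ β = (s - a) * (s - a) ^ (β - 1) := by
      nth_rewrite 2 [← Real.rpow_one (s - a)]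
      rw [← Real.rpow_add hu]; congr 1; ring
    have eq2 : (s - a) ^ β = (s - a) ^ 2 * (s - a) ^ (β - 2) := by
      rw [← Real.rpow_natCast (s - a) 2, ← Real.rpow_add hu]; congr 1; push_cast; ring
    have hW : |W s| ≤ M * (s - a) := by
      rw [abs_of_nonneg (le_trans (by positivity) (hWl s hsI))]; exact hWu s hsI
    have hK : |K s| ≤ M * (s - a) ^ 2 := by
      rw [abs_of_nonneg (le_trans (by positivity) (hKl s hsI))]
      refine (hKu s hsI).trans ?_
      have : 0 ≤ M * (s - a) ^ 2 := by positivity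
      linarith
    have hr : |p s - p b - (s - b) * q b| ≤ C * (s - a) ^ (β - 1) + (|p b| + (b - a) * |q b|) := by
      have h1 := abs_sub (p s - p b) ((s - b) * q b)
      have h2 := abs_sub (p s) (p b)
      rw [abs_mul] at h1
      have h3 : |s - b| ≤ b - a := by rw [abs_le]; constructor <;> linarith [hs.1, hs.2]
      have := mul_le_mul_of_nonneg_right h3 (abs_nonneg (q b))
      linarith
    have hr2 : |q s - q b| ≤ C * (s - a) ^ (β - 2) + |q b| := by
      have h2 := abs_sub (q s) (q b)
      linarith
    rw [Real.norm_eq_abs]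
    calc |F s| ≤ |W s * (p s - p b - (s - b) * q b)| + |K s * (q s - q b)| := abs_sub _ _
      _ = |W s| * |p s - p b - (s - b) * q b| + |K s| * |q s - q b| := by rw [abs_mul, abs_mul]
      _ ≤ M * (s - a) * (C * (s - a) ^ (β - 1) + (|p b| + (b - a) * |q b|)) +
          M * (s - a) ^ 2 * (C * (s - a) ^ (β - 2) + |q b|) := by
          gcongr
      _ = M * (C * ((s - a) * (s - a) ^ (β - 1)) + (s - a) * (|p b| + (b - a) * |q b|)) + 
      M * (C * ((s - a) ^ 2 * (s - a) ^ (β - 2)) + (s - a) ^ 2 * |q b|) := by ring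
      _ = G s := by rw [← ep, ← eq2]
  have := integral_eq_sub_of_hasDerivAt_of_tendsto hab (f := F)
    (fun s hs => hFd s ⟨hs.1, hs.2.le⟩) (hwr.sub hKz) hFa hFb
  rw [this]; simp

lemma Reg.ftc (H : Reg T C β v p q z) {a b : ℝ} (ha : 0 ≤ a) (hab : a ≤ b) (hb : b ≤ T) :
    ∫ s in a..b, p s = v b - v a := by
  refine integral_eq_sub_of_hasDerivAt_of_le hab (H.2.2.2.1.mono (Icc_subset_Icc ha hb)) ?_ (H.intP ha hab hb)
  intro s hs
  exact H.2.2.2.2.1 s ⟨by linarith [hs.1], by linarith [hs.2]⟩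

lemma Reg.taylorL (H : Reg T C β v p q z) {a b : ℝ} (ha : 0 ≤ a) (hab : a < b) (hb : b ≤ T) :
    v b - v a = p b * (b - a) - q b * (b - a) ^ 2 / 2 + ∫ s in a..b, (s - a) ^ 2 / 2 * z s := by
  obtain ⟨K, -, h1, h2, h3, h4⟩ := H.left ha hab hb (w0 := fun _ => 1) continuousOn_const zero_le_one
    (fun _ _ => le_rfl) (fun _ _ => le_rfl)
  have e : ∫ s in a..b, K s * z s = ∫ s in a..b, (s - a) ^ 2 / 2 * z s := by
    apply intervalIntegral.integral_congr
    intro s hs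
    rw [uIcc_of_le hab.le] at hs
    have : K s = (s - a) ^ 2 / 2 := by linarith [h1 s hs, h2 s hs]
    simp only [this]
  rw [← e, ← h4]
  simp only [one_mul]
  have e2 : ∫ s in a..b, (s - b) = - (b - a) ^ 2 / 2 := by
    rw [intervalIntegral.integral_comp_sub_right (fun x => x) b]
    simp; ring
  rw [intervalIntegral.integral_sub ((H.intP ha hab.le hb).sub (by simp)) (Continuous.intervalIntegrable (by fun_prop) _ _),
    intervalIntegral.integral_sub (H.intP ha hab.le hb) (by simp), H.ftc ha hab.le hb,
    intervalIntegral.integral_mul_const, e2]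
  simp
  ring

lemma Reg.taylorR (H : Reg T C β v p q z) {c d : ℝ} (hc : 0 < c) (hcd : c < d) (hd : d ≤ T) :
    v d - v c = p c * (d - c) + q c * (d - c) ^ 2 / 2 + ∫ s in c..d, (d - s) ^ 2 / 2 * z s := by
  have hsub : ∀ s ∈ Icc c d, s ∈ Ioc 0 T := fun s hs => ⟨by linarith [hs.1], by linarith [hs.2]⟩
  have := integral_eq_sub_of_hasDerivAt (a := c) (b := d)
    (f := fun s => v s + (d - s) * p s + (d - s) ^ 2 / 2 * q s)
    (f' := fun s => (d - s) ^ 2 / 2 * z s) ?_ (H.intKz_pos hc hcd.le hd (Continuous.continuousOn (by fun_prop)))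
  · rw [this]; simp; ring
  · intro s hs
    rw [uIcc_of_le hcd.le] at hs
    have hv := H.2.2.2.2.1 s (hsub s hs)
    have hp := H.2.2.2.2.2.1 s (hsub s hs)
    have hq := H.2.2.2.2.2.2.1 s (hsub s hs)
    have hl : HasDerivAt (fun s : ℝ => d - s) (-1) s := by simpa using (hasDerivAt_id s).const_sub d
    have h1 := (hv.add (hl.mul hp)).add (((hl.pow 2).div_const 2).mul hq)
    refine h1.congr_deriv ?_
    simp; ring
end

section
variable {T C β : ℝ} {v p q z : ℝ → ℝ}

set_option maxHeartbeats 1000000 in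
lemma Reg.hist (H : Reg T C β v p q z) {a b d : ℝ} (ha : 0 ≤ a) (hab : a < b) (hbd : b < d) (hd : d ≤ T)
    {w : ℝ → ℝ} (hw : ContinuousOn w (Icc a b)) (hm0 : 0 ≤ w a)
    (hm : ∀ s ∈ Icc a b, w a ≤ w s) (hM : ∀ s ∈ Icc a b, w s ≤ w b)
    {I J bb D : ℝ} (hI : I = ∫ s in a..b, w s) (hJ : J = ∫ s in a..b, (s - (a + b) / 2) * w s)
    (hbb : bb * ((b - a) * (d - a)) = 2 * J) (hbb0 : 0 ≤ bb)
    (h1 : w b - I / (b - a) + bb ≤ 5 * D) (h2 : I / (b - a) - w a ≤ 5 * D)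
    (h3 : (b - a) / (d - b) * bb ≤ 5 * D) :
    |(∫ s in a..b, w s * p s) - I / (b - a) * (v b - v a) -
      bb * ((b - a) / (d - b) * (v d - v b) - (v b - v a))| ≤
    D * (5/2 * (∫ s in a..b, (s - a) ^ 2 * |z s|) + 5/2 * ∫ s in b..d, (d - s) ^ 2 * |z s|) := by
  have hbT : b ≤ T := by linarith
  have hb0 : 0 < b := by linarith
  obtain ⟨K, hKc, hKl, hKu, hKz, hKe⟩ := H.left ha hab hbT hw hm0 hm hM
  have hTl := H.taylorL ha hab hbT
  have hTr := H.taylorR hb0 hbd hd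
  have hwi : IntervalIntegrable w volume a b := 
    ContinuousOn.intervalIntegrable_of_Icc hab.le hw
  have hwp : IntervalIntegrable (fun s => w s * p s) volume a b :=
    (H.intP ha hab.le hbT).continuousOn_mul (by rwa [uIcc_of_le hab.le])
  have hws : IntervalIntegrable (fun s => (s - (a + b) / 2) * w s) volume a b :=
    hwi.continuousOn_mul (by fun_prop)
  have e1 : ∫ s in a..b, w s * (p s - p b - (s - b) * q b) =
      (∫ s in a..b, w s * p s) - p b * I - q b * (J - (b - a) / 2 * I) := by
    have : ∀ s, w s * (p s - p b - (s - b) * q b) = 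
      w s * p s - (p b - (b - a) / 2 * q b) * w s - q b * ((s - (a + b) / 2) * w s) := by
      intro s; ring
    simp only [this]
    rw [intervalIntegral.integral_sub (hwp.sub (hwi.const_mul _)) (hws.const_mul _),
      intervalIntegral.integral_sub hwp (hwi.const_mul _), intervalIntegral.integral_const_mul,
      intervalIntegral.integral_const_mul, ← hI, ← hJ]
    ring
  have hZa : IntervalIntegrable (fun s => (s - a) ^ 2 / 2 * z s) volume a b := by
    refine H.intKz (M := 1 / 2) ha hab.le hbT (Continuous.continuousOn (by fun_prop)) ?_
    intro s hs
    rw [abs_of_nonneg (by positivity)]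
    nlinarith [hs.1]
  have hZa' : IntervalIntegrable (fun s => (s - a) ^ 2 * |z s|) volume a b := by
    refine int_abs hab.le ?_ (fun s _ => by positivity)
    convert hZa.const_mul 2 using 2
    ring
  have hZd : IntervalIntegrable (fun s => (d - s) ^ 2 / 2 * z s) volume b d :=
    H.intKz_pos hb0 hbd.le hd (Continuous.continuousOn (by fun_prop))
  have hZd' : IntervalIntegrable (fun s => (d - s) ^ 2 * |z s|) volume b d := by
    refine int_abs hbd.le ?_ (fun s _ => by positivity)
    exact H.intKz_pos hb0 hbd.le hd (Continuous.continuousOn (by fun_prop))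
  set ZL := ∫ s in a..b, (s - a) ^ 2 / 2 * z s with hZL
  set ZR := ∫ s in b..d, (d - s) ^ 2 / 2 * z s with hZR
  set g := I / (b - a) - bb with hg
  have hid : (∫ s in a..b, w s * p s) - I / (b - a) * (v b - v a) -
      bb * ((b - a) / (d - b) * (v d - v b) - (v b - v a)) =
      (∫ s in a..b, (K s - g * ((s - a) ^ 2 / 2)) * z s) - bb * ((b - a) / (d - b)) * ZR := by
    have e2 : ∫ s in a..b, (K s - g * ((s - a) ^ 2 / 2)) * z s = (∫ s in a..b, K s * z s) - g * ZL := by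
      have : ∀ s, (K s - g * ((s - a) ^ 2 / 2)) * z s = K s * z s - g * ((s - a) ^ 2 / 2 * z s) := by
        intro s; ring
      simp only [this]
      rw [intervalIntegral.integral_sub hKz (hZa.const_mul _), intervalIntegral.integral_const_mul]
    rw [e2, ← hKe, e1, hTl, hTr, hg]
    have hh : b - a ≠ 0 := by linarith
    have hh2 : d - b ≠ 0 := by linarith
    have hJ2 : J = bb * ((b - a) * (d - a)) / 2 := by linarith
    rw [hJ2]
    field_simp
    ring
  rw [hid]
  have hZLb : |∫ s in a..b, (K s - g * ((s - a) ^ 2 / 2)) * z s| ≤ 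
      ∫ s in a..b, (5 / 2 * D) * ((s - a) ^ 2 * |z s|) := by
    rw [← Real.norm_eq_abs]
    refine norm_integral_le_of_norm_le hab.le ?_ (hZa'.const_mul _)
    refine Eventually.of_forall fun s hs => ?_
    have hsI : s ∈ Icc a b := ⟨hs.1.le, hs.2⟩
    rw [Real.norm_eq_abs, abs_mul, ← mul_assoc]
    refine mul_le_mul_of_nonneg_right ?_ (abs_nonneg _)
    have k1 := hKl s hsI
    have k2 := hKu s hsI
    have hu : 0 ≤ (s - a) ^ 2 := by positivity
    rw [abs_le]
    constructor
    · have := mul_le_mul_of_nonneg_right (show g - w a ≤ 5 * D by linarith) hu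
      linarith
    · have := mul_le_mul_of_nonneg_right (show w b - g ≤ 5 * D by linarith) hu
      linarith
  have hZRb : |bb * ((b - a) / (d - b)) * ZR| ≤ (5 / 2 * D) * ∫ s in b..d, (d - s) ^ 2 * |z s| := by
    have hr : 0 ≤ (b - a) / (d - b) := div_nonneg (by linarith) (by linarith)
    have : |ZR| ≤ ∫ s in b..d, 1 / 2 * ((d - s) ^ 2 * |z s|) := by
      rw [← Real.norm_eq_abs]
      refine norm_integral_le_of_norm_le hbd.le ?_ (hZd'.const_mul _)
      refine Eventually.of_forall fun s hs => ?_
      rw [Real.norm_eq_abs, abs_mul, abs_of_nonneg (by positivity)]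
      apply le_of_eq; ring
    rw [intervalIntegral.integral_const_mul] at this
    rw [abs_mul, abs_of_nonneg (by positivity)]
    have h0 : 0 ≤ ∫ s in b..d, (d - s) ^ 2 * |z s| :=
      intervalIntegral.integral_nonneg hbd.le (fun s _ => by positivity)
    have h5 : bb * ((b - a) / (d - b)) ≤ 5 * D := by linarith
    have h6 : 0 ≤ bb * ((b - a) / (d - b)) := by positivity
    calc _ ≤ (5 * D) * (1 / 2 * ∫ s in b..d, (d - s) ^ 2 * |z s|) := by
          apply mul_le_mul h5 this (abs_nonneg _) (by linarith)
      _ = _ := by ring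
  rw [intervalIntegral.integral_const_mul] at hZLb
  have := abs_sub (∫ s in a..b, (K s - g * ((s - a) ^ 2 / 2)) * z s) (bb * ((b - a) / (d - b)) * ZR)
  linarith
end

lemma kern {a b : ℝ} (hab : a < b) {w w1 : ℝ → ℝ} (hd : ∀ s ∈ Icc a b, HasDerivAt w (w1 s) s)
    (hc : ContinuousOn w1 (Icc a b)) (hmono : MonotoneOn w1 (Icc a b)) (h0 : 0 ≤ w1 a) 
    {I J : ℝ} (hI : I = ∫ s in a..b, w s) (hJ : J = ∫ s in a..b, (s - (a + b) / 2) * w s) :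
    0 ≤ J ∧ J ≤ w1 b * (b - a) ^ 3 / 12 ∧ w1 a * (b - a) ^ 2 / 2 ≤ (b - a) * w b - I ∧
    I - (b - a) * w a ≤ (b - a) * w b - I ∧ J ≤ (b - a) / 2 * (I - (b - a) * w a) := by
  have hA : a ∈ Icc a b := ⟨le_rfl, hab.le⟩
  have hB : b ∈ Icc a b := ⟨hab.le, le_rfl⟩
  have hwc : ContinuousOn w (Icc a b) := fun s hs => (hd s hs).continuousAt.continuousWithinAt
  have hu := uIcc_of_le hab.le
  -- integration by parts
  have ibp : ∀ f f' : ℝ → ℝ, (∀ s, HasDerivAt f (f' s) s) → Continuous f' →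
      ∫ s in a..b, f s * w1 s = f b * w b - f a * w a - ∫ s in a..b, f' s * w s := by
    intro f f' hf hf'
    refine integral_mul_deriv_eq_deriv_mul (fun s _ => hf s) (fun s hs => hd s (by rwa [← hu])) 
      (hf'.intervalIntegrable _ _) (ContinuousOn.intervalIntegrable (by rwa [hu]))
  have I1 : ∫ s in a..b, (s - a) * w1 s = (b - a) * w b - I := by
    rw [ibp (fun s => s - a) (fun _ => 1) (fun s => (hasDerivAt_id s).sub_const a) continuous_const, hI]
    simp
  have I2 : ∫ s in a..b, (b - s) * w1 s = I - (b - a) * w a := by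
    rw [ibp (fun s => b - s) (fun _ => -1) (fun s => by simpa using (hasDerivAt_id s).const_sub b) continuous_const, hI]
    simp; ring
  have I3 : ∫ s in a..b, ((s - a) * (b - s) / 2) * w1 s = J := by
    rw [ibp (fun s => (s - a) * (b - s) / 2) (fun s => - (s - (a + b) / 2)) (fun s => ?_) (by fun_prop), hJ]
    · simp only [neg_mul, intervalIntegral.integral_neg]; ring
    · have := (((hasDerivAt_id s).sub_const a).mul ((hasDerivAt_id s).const_sub b)).div_const 2
      refine this.congr_deriv ?_
      simp; ring
  have int : ∀ f : ℝ → ℝ, Continuous f → IntervalIntegrable (fun s => f s * w1 s) volume a b := by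
    intro f hf
    refine ContinuousOn.intervalIntegrable ?_
    rw [hu]
    exact hf.continuousOn.mul hc
  have hpos : ∀ s ∈ Icc a b, 0 ≤ w1 s := fun s hs => h0.trans (hmono hA hs hs.1)
  have P1 : ∫ s in a..b, (s - a) * w1 a = w1 a * (b - a) ^ 2 / 2 := by
    rw [intervalIntegral.integral_mul_const, intervalIntegral.integral_comp_sub_right (fun x => x) a]
    simp; ring
  have P3 : ∫ s in a..b, ((s - a) * (b - s) / 2) * w1 b = w1 b * (b - a) ^ 3 / 12 := by
    rw [intervalIntegral.integral_mul_const]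
    have : ∫ s in a..b, ((s - a) * (b - s) / 2) = (b - a) ^ 3 / 12 := by
      rw [integral_eq_sub_of_hasDerivAt (f := fun s => (s - a) ^ 2 * (b - a) / 4 - (s - a) ^ 3 / 6)]
      · simp; ring
      · intro s _
        have hl := (hasDerivAt_id s).sub_const a
        have := (((hl.pow 2).mul_const (b - a)).div_const 4).sub ((hl.pow 3).div_const 6)
        refine this.congr_deriv ?_
        simp; ring
      · exact Continuous.intervalIntegrable (by fun_prop) _ _
    rw [this]; ring
  refine ⟨?_, ?_, ?_, ?_, ?_⟩
  · rw [← I3]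
    refine intervalIntegral.integral_nonneg hab.le fun s hs => ?_
    have := hpos s hs
    have h1 : 0 ≤ s - a := by linarith [hs.1]
    have h2 : 0 ≤ b - s := by linarith [hs.2]
    positivity
  · rw [← I3, ← P3]
    refine integral_mono_on hab.le (int _ (by fun_prop)) (Continuous.intervalIntegrable (by fun_prop) _ _) fun s hs => ?_
    have h1 : 0 ≤ s - a := by linarith [hs.1]
    have h2 : 0 ≤ b - s := by linarith [hs.2]
    exact mul_le_mul_of_nonneg_left (hmono hs hB hs.2) (by positivity)
  · rw [← I1, ← P1]
    refine integral_mono_on hab.le (Continuous.intervalIntegrable (by fun_prop) _ _) (int _ (by fun_prop)) fun s hs => ?_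
    exact mul_le_mul_of_nonneg_left (hmono hA hs hs.1) (by linarith [hs.1])
  · rw [← I1, ← I2, ← sub_nonneg, ← intervalIntegral.integral_sub (int _ (by fun_prop)) (int _ (by fun_prop))]
    have hmid : (a + b) / 2 ∈ Icc a b := ⟨by linarith, by linarith⟩
    have : ∫ s in a..b, (2 * s - a - b) * w1 ((a + b) / 2) = 0 := by
      rw [intervalIntegral.integral_mul_const]
      have : ∫ s in a..b, (2 * s - a - b) = 0 := by
        rw [integral_eq_sub_of_hasDerivAt (f := fun s => s ^ 2 - (a + b) * s)]
        · ring
        · intro s _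
          have := ((hasDerivAt_id s).pow 2).sub ((hasDerivAt_id s).const_mul (a + b))
          refine this.congr_deriv ?_
          simp; ring
        · exact Continuous.intervalIntegrable (by fun_prop) _ _
      rw [this]; ring
    rw [← this]
    refine integral_mono_on hab.le (Continuous.intervalIntegrable (by fun_prop) _ _)
      ((int _ (by fun_prop)).sub (int _ (by fun_prop))) fun s hs => ?_
    rcases le_total s ((a + b) / 2) with h | h
    · have := hmono hs hmid h
      nlinarith
    · have := hmono hmid hs h
      nlinarith
  · rw [← I3, ← I2, ← intervalIntegral.integral_const_mul]
    refine integral_mono_on hab.le (int _ (by fun_prop)) ((int _ (by fun_prop)).const_mul _) fun s hs => ?_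
    have := hpos s hs
    have h1 : 0 ≤ b - s := by linarith [hs.2]
    have h2 : s - a ≤ b - a := by linarith [hs.2]
    have h3 : 0 ≤ (b - s) * w1 s := by positivity
    nlinarith

section
variable {T C β : ℝ} {v p q z : ℝ → ℝ}

lemma wint {α x y : ℝ} (h1 : -1 < α) : 
    ∫ s in y..x, (x - s) ^ α = (x - y) ^ (α + 1) / (α + 1) := by
  rw [intervalIntegral.integral_comp_sub_left (fun s => s ^ α) x, integral_rpow (Or.inl h1), sub_self,
    Real.zero_rpow (by linarith)]
  simp

lemma wii {α x y c : ℝ} (h1 : -1 < α) : IntervalIntegrable (fun s => (x - s) ^ α) volume y c := by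
  have := (intervalIntegrable_rpow' h1 (a := x - y) (b := x - c)).comp_sub_left x
  simpa using this

lemma wder {α x s : ℝ} (hs : s < x) : 
    HasDerivAt (fun s => (x - s) ^ α) (-(α * (x - s) ^ (α - 1))) s := by
  have hl : HasDerivAt (fun s : ℝ => x - s) (-1) s := by simpa using (hasDerivAt_id s).const_sub x
  have := hl.rpow_const (p := α) (Or.inl (by linarith))
  refine this.congr_deriv ?_
  ring

lemma Reg.right (H : Reg T C β v p q z) {α c x : ℝ} (hα0 : 0 < α) (hα1 : α < 1) (hc : 0 < c) (hcx : c < x) (hx : x ≤ T) :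
    ∫ s in c..x, (x - s) ^ (-α) * (p s - p c - (s - c) * q c) =
      ∫ s in c..x, (x - s) ^ (2 - α) / ((1 - α) * (2 - α)) * z s := by
  have hsub : Icc c x ⊆ Ioc 0 T := fun s hs => ⟨by linarith [hs.1], by linarith [hs.2]⟩
  have hpc : ContinuousOn (fun s => p s - p c - (s - c) * q c) (Icc c x) :=
    ((H.contP.mono hsub).sub continuousOn_const).sub (Continuous.continuousOn (by fun_prop))
  have hqc : ContinuousOn (fun s => q s - q c) (Icc c x) := (H.contQ.mono hsub).sub continuousOn_const
  have c1 : Continuous (fun s : ℝ => (x - s) ^ (1 - α)) := 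
    Continuous.rpow_const (by fun_prop) (fun _ => Or.inr (by linarith))
  have c2 : Continuous (fun s : ℝ => (x - s) ^ (2 - α)) := 
    Continuous.rpow_const (by fun_prop) (fun _ => Or.inr (by linarith))
  have i1 : IntervalIntegrable (fun s => (x - s) ^ (-α) * (p s - p c - (s - c) * q c)) volume c x :=
    (wii (by linarith)).mul_continuousOn (by rwa [uIcc_of_le hcx.le])
  have i2 : IntervalIntegrable (fun s => (x - s) ^ (2 - α) / ((1 - α) * (2 - α)) * z s) volume c x :=
    H.intKz_pos hc hcx.le hx (c2.div_const _).continuousOn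
  rw [← sub_eq_zero, ← intervalIntegral.integral_sub i1 i2]
  rw [integral_eq_sub_of_hasDerivAt_of_le (f := fun s => -((x - s) ^ (1 - α) / (1 - α)) * (p s - p c - (s - c) * q c) -
    (x - s) ^ (2 - α) / ((1 - α) * (2 - α)) * (q s - q c)) hcx.le ?_ ?_ (i1.sub i2)]
  · simp [Real.zero_rpow (show 1 - α ≠ 0 by linarith), Real.zero_rpow (show 2 - α ≠ 0 by linarith)]
  · refine ContinuousOn.sub (ContinuousOn.mul (c1.div_const _).neg.continuousOn hpc) (ContinuousOn.mul (c2.div_const _).continuousOn hqc)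
  · intro s hs
    have hp := H.2.2.2.2.2.1 s (hsub ⟨hs.1.le, hs.2.le⟩)
    have hq := H.2.2.2.2.2.2.1 s (hsub ⟨hs.1.le, hs.2.le⟩)
    have d1 := ((wder (α := 1 - α) hs.2).div_const (1 - α)).neg
    have d2 := (wder (α := 2 - α) hs.2).div_const ((1 - α) * (2 - α))
    have := (d1.mul ((hp.sub_const (p c)).sub (((hasDerivAt_id s).sub_const c).mul_const (q c)))).sub
      (d2.mul (hq.sub_const (q c)))
    refine this.congr_deriv ?_
    have e1 : (1 - α - 1) = -α := by ring
    have e2 : (2 - α - 1) = 1 - α := by ring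
    rw [e1, e2]
    have n1 : 1 - α ≠ 0 := by linarith
    have n2 : 2 - α ≠ 0 := by linarith
    simp
    field_simp
    ring

set_option maxHeartbeats 1000000 in
lemma Reg.loc (H : Reg T C β v p q z) {α a d x : ℝ} (hα0 : 0 < α) (hα1 : α < 1) (ha : 0 ≤ a) (had : a < d)
    (hd : d ≤ T) (hx : x = α / 2 * a + (1 - α / 2) * d) {A : ℝ}
    (hA : A = 1 / (d - a) * ∫ s in a..x, (x - s) ^ (-α)) :
    |(∫ s in a..x, (x - s) ^ (-α) * p s) - A * (v d - v a)| ≤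
      A * (3 / 2 * (∫ s in a..((a + d) / 2), (s - a) ^ 2 * |z s|) +
        3 * (d - a) / 2 * ∫ s in ((a + d) / 2)..d, (d - s) * |z s|) := by
  set c := (a + d) / 2 with hc
  have hac : a < c := by rw [hc]; linarith
  have hcd : c < d := by rw [hc]; linarith
  have hxc : x - c = (1 - α) * (d - a) / 2 := by rw [hx, hc]; ring
  have hxa : x - a = (1 - α / 2) * (d - a) := by rw [hx]; ring
  have hda : 0 < d - a := by linarith
  have hcx : c < x := by nlinarith
  have hxd : x ≤ d := by nlinarith
  have hc0 : 0 < c := by linarith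
  have n1 : 0 < 1 - α := by linarith
  have n2 : 0 < 2 - α := by linarith
  set w : ℝ → ℝ := fun s => (x - s) ^ (-α) with hw
  have hwI : ∀ y, ∫ s in y..x, w s = (x - y) ^ (1 - α) / (1 - α) := by
    intro y
    have := wint (α := -α) (x := x) (y := y) (by linarith)
    rw [show -α + 1 = 1 - α by ring] at this
    exact this
  have hAe : A * (d - a) = (x - a) ^ (1 - α) / (1 - α) := by
    rw [hA, hwI]; field_simp
  have hA0 : 0 < A := by
    have : 0 < (x - a) ^ (1 - α) / (1 - α) := div_pos (Real.rpow_pos_of_pos (by linarith) _) n1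
    by_contra h
    nlinarith
  have hwc : ContinuousOn w (Icc a c) := by
    intro s hs
    exact (wder (by linarith [hs.2])).continuousAt.continuousWithinAt
  have hwm : ∀ s ∈ Icc a c, w s ≤ 2 * A := by
    intro s hs
    have h1 : w s ≤ w c := Real.rpow_le_rpow_of_nonpos (by linarith) (by linarith [hs.2]) (by linarith)
    have h2 : w c * (d - a) / 2 = (x - c) ^ (1 - α) / (1 - α) := by
      have : (x - c) ^ (1 - α) = (x - c) ^ (-α) * (x - c) := by
        rw [← Real.rpow_add_one (by linarith)]; congr 1; ring
      rw [this]; rw [show (x - c) ^ (-α) = w c from rfl, hxc]; field_simp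
    have h3 : (x - c) ^ (1 - α) / (1 - α) ≤ (x - a) ^ (1 - α) / (1 - α) := by
      apply div_le_div_of_nonneg_right _ n1.le
      exact Real.rpow_le_rpow (by linarith) (by linarith) n1.le
    rw [← h2, ← hAe] at h3
    have : w c ≤ 2 * A := by
      by_contra h
      nlinarith
    linarith
  obtain ⟨K, hKc, hKl, hKu, hKz, hKe⟩ := H.left ha hac (by linarith) hwc le_rfl 
    (fun s hs => Real.rpow_nonneg (by linarith [hs.2]) _) hwm
  have hTl := H.taylorL ha hac (by linarith)
  have hTr := H.taylorR hc0 hcd hd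
  have hR := H.right hα0 hα1 hc0 hcx (by linarith)
  have wi : ∀ y y', IntervalIntegrable w volume y y' := fun y y' => wii (by linarith)
  have ip1 : IntervalIntegrable (fun s => w s * p s) volume a c :=
    (H.intP ha hac.le (by linarith)).continuousOn_mul (by rwa [uIcc_of_le hac.le])
  have ip2 : IntervalIntegrable (fun s => w s * p s) volume c x := by
    refine (wi c x).mul_continuousOn ?_
    rw [uIcc_of_le hcx.le]
    exact H.contP.mono fun s hs => ⟨by linarith [hs.1], by linarith [hs.2]⟩
  have iw : ∀ y y', IntervalIntegrable (fun s => (s - c) * w s) volume y y' := fun y y' =>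
    (wi y y').continuousOn_mul (by fun_prop)
  have exp : ∀ y y', IntervalIntegrable (fun s => w s * p s) volume y y' →
     ∫ s in y..y', w s * (p s - p c - (s - c) * q c) = (∫ s in y..y', w s * p s) - p c * (∫ s in y..y', w s)
      - q c * ∫ s in y..y', (s - c) * w s := by
    intro y y' hi
    have : ∀ s, w s * (p s - p c - (s - c) * q c) = w s * p s - p c * w s - q c * ((s - c) * w s) := by
      intro s; ring
    simp only [this]
    rw [intervalIntegral.integral_sub (hi.sub ((wi _ _).const_mul _)) ((iw _ _).const_mul _),
      intervalIntegral.integral_sub hi ((wi _ _).const_mul _), intervalIntegral.integral_const_mul,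
      intervalIntegral.integral_const_mul]
  have hzero : ∫ s in a..x, (s - c) * w s = 0 := by
    have : ∫ s in a..x, (s - c) * w s = ∫ s in a..x, ((x - c) * w s - (x - s) ^ (1 - α)) := by
      apply intervalIntegral.integral_congr
      intro s hs
      rw [uIcc_of_le (by linarith)] at hs
      simp only
      rcases eq_or_lt_of_le hs.2 with h | h
      · rw [h]; simp [Real.zero_rpow n1.ne']
      · have : (x - s) ^ (1 - α) = (x - s) ^ (-α) * (x - s) := by
          rw [← Real.rpow_add_one (by linarith)]; congr 1; ring
        rw [this]
        change _ = (x - c) * w s - w s * (x - s)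
        ring
    rw [this, intervalIntegral.integral_sub ((wi _ _).const_mul _) (wii (by linarith)), 
      intervalIntegral.integral_const_mul, hwI, wint (by linarith)]
    have e : (x - a) ^ (1 - α + 1) = (x - a) ^ (1 - α) * (x - a) := 
      Real.rpow_add_one (by linarith) _
    rw [e, hxc, hxa]
    have : 1 - α + 1 ≠ 0 := by linarith
    field_simp
    ring
  have hs1 := integral_add_adjacent_intervals ip1 ip2
  have hs2 := integral_add_adjacent_intervals (wi a c) (wi c x)
  have hs3 := integral_add_adjacent_intervals (iw a c) (iw c x)
  have x1 := exp a c ip1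
  have x2 := exp c x ip2
  rw [hKe] at x1
  rw [hR] at x2
  have hZa : IntervalIntegrable (fun s => (s - a) ^ 2 / 2 * z s) volume a c := by
    refine H.intKz (M := 1 / 2) ha hac.le (by linarith) (Continuous.continuousOn (by fun_prop)) ?_
    intro s hs
    rw [abs_of_nonneg (by positivity)]
    nlinarith [hs.1]
  have hZa' : IntervalIntegrable (fun s => (s - a) ^ 2 * |z s|) volume a c := by
    refine int_abs hac.le ?_ (fun s _ => by positivity)
    convert hZa.const_mul 2 using 2
    ring
  have hZd : IntervalIntegrable (fun s => (d - s) * |z s|) volume c d := by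
    refine int_abs hcd.le ?_ (fun s hs => by linarith [hs.2])
    exact H.intKz_pos hc0 hcd.le hd (Continuous.continuousOn (by fun_prop))
  set ZL := ∫ s in a..c, (s - a) ^ 2 / 2 * z s with hZL
  set ZR := ∫ s in c..d, (d - s) ^ 2 / 2 * z s with hZR
  set X2 := ∫ s in c..x, (x - s) ^ (2 - α) / ((1 - α) * (2 - α)) * z s with hX2
  have hAI : ∫ s in a..x, w s = A * (d - a) := by rw [hwI, hAe]
  have hid : (∫ s in a..x, w s * p s) - A * (v d - v a) =
      (∫ s in a..c, (K s - A * ((s - a) ^ 2 / 2)) * z s) + (X2 - A * ZR) := by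
    have e2 : ∫ s in a..c, (K s - A * ((s - a) ^ 2 / 2)) * z s = (∫ s in a..c, K s * z s) - A * ZL := by
      have : ∀ s, (K s - A * ((s - a) ^ 2 / 2)) * z s = K s * z s - A * ((s - a) ^ 2 / 2 * z s) := by
        intro s; ring
      simp only [this]
      rw [intervalIntegral.integral_sub hKz (hZa.const_mul _), intervalIntegral.integral_const_mul]
    rw [e2, x1, x2]
    have ev : v d - v a = p c * (d - a) + ZL + ZR := by
      have : v d - v a = (v d - v c) + (v c - v a) := by ring
      rw [this, hTl, hTr, hc]; ring
    rw [ev, ← hs1]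
    rw [hAI] at hs2
    rw [hzero] at hs3
    linear_combination p c * hs2 + q c * hs3
  have hZLb : |∫ s in a..c, (K s - A * ((s - a) ^ 2 / 2)) * z s| ≤ 
      ∫ s in a..c, (3 / 2 * A) * ((s - a) ^ 2 * |z s|) := by
    rw [← Real.norm_eq_abs]
    refine norm_integral_le_of_norm_le hac.le ?_ (hZa'.const_mul _)
    refine Eventually.of_forall fun s hs => ?_
    have hsI : s ∈ Icc a c := ⟨hs.1.le, hs.2⟩
    rw [Real.norm_eq_abs, abs_mul, ← mul_assoc]
    refine mul_le_mul_of_nonneg_right ?_ (abs_nonneg _)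
    have k1 := hKl s hsI
    have k2 := hKu s hsI
    have hu : 0 ≤ A * (s - a) ^ 2 := by positivity
    rw [abs_le]
    constructor <;> linarith
  have hX2b : |X2| ≤ (A * (d - a)) * ∫ s in c..d, (d - s) * |z s| := by
    have s1 : |X2| ≤ ∫ s in c..x, (A * (d - a)) * ((d - s) * |z s|) := by
      rw [← Real.norm_eq_abs]
      have hsub : IntervalIntegrable (fun s => (d - s) * |z s|) volume c x := by
        refine hZd.mono_set ?_
        rw [uIcc_of_le hcd.le, uIcc_of_le hcx.le]; exact Icc_subset_Icc le_rfl hxd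
      refine norm_integral_le_of_norm_le hcx.le ?_ (hsub.const_mul _)
      refine Eventually.of_forall fun s hs => ?_
      rw [Real.norm_eq_abs, abs_mul, ← mul_assoc]
      refine mul_le_mul_of_nonneg_right ?_ (abs_nonneg _)
      have hxs : 0 ≤ x - s := by linarith [hs.2]
      rw [abs_of_nonneg (by positivity)]
      have e : (x - s) ^ (2 - α) = (x - s) ^ (1 - α) * (x - s) := by
        rcases eq_or_lt_of_le hxs with h | h
        · rw [← h]; simp [Real.zero_rpow n2.ne']
        · rw [← Real.rpow_add_one h.ne']; congr 1; ring
      have h1 : (x - s) ^ (1 - α) ≤ (x - a) ^ (1 - α) := 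
        Real.rpow_le_rpow hxs (by linarith [hs.1]) n1.le
      rw [e, hAe]
      have h2 : 0 ≤ (x - s) ^ (1 - α) := by positivity
      calc (x - s) ^ (1 - α) * (x - s) / ((1 - α) * (2 - α)) = 
            ((x - s) ^ (1 - α) / (1 - α)) * ((x - s) / (2 - α)) := by field_simp
        _ ≤ ((x - a) ^ (1 - α) / (1 - α)) * (d - s) := by
            have h4 : (x - s) / (2 - α) ≤ d - s := by
              rw [div_le_iff₀ n2]
              nlinarith
            exact mul_le_mul (div_le_div_of_nonneg_right h1 n1.le) h4 (div_nonneg hxs n2.le)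
              (div_nonneg (h2.trans h1) n1.le)
    have s2 : ∫ s in c..x, (d - s) * |z s| ≤ ∫ s in c..d, (d - s) * |z s| := by
      refine integral_mono_interval le_rfl hcx.le hxd ?_ hZd
      filter_upwards [ae_restrict_mem measurableSet_Ioc] with s hs
      exact mul_nonneg (by linarith [hs.2]) (abs_nonneg _)
    rw [intervalIntegral.integral_const_mul] at s1
    exact s1.trans (mul_le_mul_of_nonneg_left s2 (by positivity))
  have hZRb : |ZR| ≤ (d - a) / 2 * ∫ s in c..d, (d - s) * |z s| := by
    have : |ZR| ≤ ∫ s in c..d, (d - a) / 2 * ((d - s) * |z s|) := by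
      rw [← Real.norm_eq_abs]
      refine norm_integral_le_of_norm_le hcd.le ?_ (hZd.const_mul _)
      refine Eventually.of_forall fun s hs => ?_
      rw [Real.norm_eq_abs, abs_mul, abs_of_nonneg (by positivity), ← mul_assoc]
      refine mul_le_mul_of_nonneg_right ?_ (abs_nonneg _)
      nlinarith [hs.1, hs.2]
    rwa [intervalIntegral.integral_const_mul] at this
  rw [intervalIntegral.integral_const_mul] at hZLb
  change |(∫ s in a..x, w s * p s) - A * (v d - v a)| ≤ _
  rw [hid]
  set Y := ∫ s in c..d, (d - s) * |z s|
  have t1 := abs_add_le (∫ s in a..c, (K s - A * ((s - a) ^ 2 / 2)) * z s) (X2 - A * ZR)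
  have t2 := abs_sub X2 (A * ZR)
  rw [abs_mul, abs_of_pos hA0] at t2
  have t3 := mul_le_mul_of_nonneg_left hZRb hA0.le
  calc _ ≤ 3 / 2 * A * (∫ s in a..c, (s - a) ^ 2 * |z s|) + (A * (d - a) * Y + A * ((d - a) / 2 * Y)) := by
        linarith
    _ = _ := by ring
end

lemma sum_Icc_shift (f : ℕ → ℝ) (n : ℕ) : ∑ k ∈ Finset.Icc 1 n, f k = ∑ i ∈ Finset.range n, f (i + 1) := by
  induction n with
  | zero => simp
  | succ n ih => rw [Finset.sum_Icc_succ_top (by omega), Finset.sum_range_succ, ih]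

lemma num1 {h h' I J w : ℝ} (hh : 0 < h) (hh' : 0 < h') (hJ0 : 0 ≤ J) (hJ : J ≤ h / 2 * (I - h * w)) :
    w ≤ 1 / h * I - 2 / (h * (h + h')) * J := by
  have h1 : 2 / (h * (h + h')) * J ≤ 2 / (h * h) * J := by
    gcongr; linarith
  have h2 : 2 / (h * h) * J ≤ 2 / (h * h) * (h / 2 * (I - h * w)) := by gcongr
  have h3 : 2 / (h * h) * (h / 2 * (I - h * w)) = 1 / h * I - w := by field_simp
  linarith

lemma num2 {h0 h I J w1 wb : ℝ} (hh0 : 0 < h0) (hh : 0 < h) (hr : h0 / h ≤ 7 / 4) (hw : 0 ≤ w1)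
    (hJ : J ≤ w1 * h0 ^ 3 / 12) (hI : w1 * h ^ 2 / 2 ≤ h * wb - I) :
    h0 / h * (2 / (h0 * (h0 + h)) * J) ≤ 4 / 5 * (wb - 1 / h * I) := by
  rw [div_le_iff₀ hh] at hr
  have h1 : h0 / h * (2 / (h0 * (h0 + h)) * J) ≤ h0 / h * (2 / (h0 * (h0 + h)) * (w1 * h0 ^ 3 / 12)) := by
    gcongr
  have h2 : h0 / h * (2 / (h0 * (h0 + h)) * (w1 * h0 ^ 3 / 12)) = w1 * (h0 ^ 3 / (6 * (h0 + h))) / h := by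
    field_simp; ring
  have h3 : h0 ^ 3 / (6 * (h0 + h)) ≤ 2 / 5 * h ^ 2 := by
    rw [div_le_iff₀ (by positivity)]
    have a1 : h0 ^ 2 ≤ (7 / 4 * h) ^ 2 := by gcongr
    have a2 : 0 ≤ h ^ 2 * h := by positivity
    have a3 : h0 ^ 3 ≤ (7 / 4 * h) ^ 2 * h0 := by nlinarith
    have a4 : h ^ 2 * h0 ≤ h ^ 2 * (7 / 4 * h) := by gcongr
    nlinarith
  have h4 : w1 * (h0 ^ 3 / (6 * (h0 + h))) / h ≤ w1 * (2 / 5 * h ^ 2) / h := by gcongr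
  have h5 : w1 * (2 / 5 * h ^ 2) / h = 4 / 5 * ((w1 * h ^ 2 / 2) / h) := by field_simp; ring
  have h6 : (w1 * h ^ 2 / 2) / h ≤ (h * wb - I) / h := by gcongr
  have h7 : (h * wb - I) / h = wb - 1 / h * I := by field_simp
  linarith

section
variable {T C β : ℝ} {v p q z : ℝ → ℝ}

set_option maxHeartbeats 2000000 in
lemma final_aux (H : Reg T C β v p q z) {α : ℝ} (hα0 : 0 < α) (hα1 : α < 1) (t : ℕ → ℝ) (m : ℕ)
    (ht0 : t 0 = 0) (hmono : ∀ j ≤ m, t j < t (j + 1)) (hT : t (m + 1) ≤ T)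
    (hρ : ∀ j < m, rhok t (j + 1) ≤ 7 / 4) :
    |caputo α p (tw (α/2) t (m + 1))
        - ∑ i ∈ Finset.range (m + 1), AK α t (m + 1) (i + 1) * (v (t (i + 1)) - v (t i))|
      ≤ AK α t (m + 1) (m + 1) * Gloc z t (m + 1)
        + ∑ i ∈ Finset.range m, (AK α t (m + 1) (i + 1 + 1) - AK α t (m + 1) (i + 1)) * Ghis z t (i + 1) := by
  have hle : ∀ i j, i ≤ j → j ≤ m + 1 → t i ≤ t j := by
    intro i j hij
    induction j, hij using Nat.le_induction with
    | base => intro _; exact le_rfl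
    | succ j hj ih => intro hjm; exact (ih (by omega)).trans (hmono j (by omega)).le
  have htnn : ∀ j ≤ m + 1, 0 ≤ t j := fun j hj => by rw [← ht0]; exact hle 0 j (by omega) hj
  set x := tw (α/2) t (m + 1) with hxd
  have hx : x = α / 2 * t m + (1 - α / 2) * t (m + 1) := by rw [hxd, tw]; simp
  have hmm := hmono m le_rfl
  have hxm : t m < x := by rw [hx]; nlinarith
  have hxT : x ≤ t (m + 1) := by rw [hx]; nlinarith
  set G := Real.Gamma (1 - α) with hGd
  have hG : 0 < G := Real.Gamma_pos_of_pos (by linarith)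
  have hG0 := hG.ne'
  set w : ℝ → ℝ := fun s => (x - s) ^ (-α) / G with hw
  set w1 : ℝ → ℝ := fun s => α * (x - s) ^ (-α - 1) / G with hw1
  have hwd : ∀ s < x, HasDerivAt w (w1 s) s := by
    intro s hs
    refine ((wder (α := -α) hs).div_const G).congr_deriv ?_
    simp only [hw1]; ring
  have hw1c : ContinuousOn w1 (Iio x) := by
    intro s hs
    exact (((wder (α := -α - 1) hs).const_mul α).div_const G).continuousAt.continuousWithinAt
  have hw1m : MonotoneOn w1 (Iio x) := by
    intro s hs s' hs' hss
    simp only [mem_Iio] at hs hs'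
    have : (x - s) ^ (-α - 1) ≤ (x - s') ^ (-α - 1) :=
      Real.rpow_le_rpow_of_nonpos (by linarith) (by linarith) (by linarith)
    simp only [hw1]
    gcongr
  have hwm : MonotoneOn w (Iio x) := by
    intro s hs s' hs' hss
    simp only [mem_Iio] at hs hs'
    have : (x - s) ^ (-α) ≤ (x - s') ^ (-α) :=
      Real.rpow_le_rpow_of_nonpos (by linarith) (by linarith) (by linarith)
    simp only [hw]
    gcongr
  have hw1p : ∀ s < x, 0 ≤ w1 s := fun s hs => by
    have : 0 < x - s := by linarith
    simp only [hw1]; positivity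
  have hwp : ∀ s < x, 0 ≤ w s := fun s hs => by
    have : 0 < x - s := by linarith
    simp only [hw]; positivity
  set I : ℕ → ℝ := fun j => ∫ s in (t j)..(t (j + 1)), w s with hI
  set J : ℕ → ℝ := fun j => ∫ s in (t j)..(t (j + 1)), (s - (t j + t (j + 1)) / 2) * w s with hJ
  have hsubx : ∀ j < m, Icc (t j) (t (j + 1)) ⊆ Iio x := fun j hj s hs => by
    have := hle (j + 1) m (by omega) (by omega)
    simp only [mem_Iio]; linarith [hs.2]
  have hlex : ∀ j ≤ m, t j < x := fun j hj => by
    have := hle j m hj (by omega)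
    linarith
  have hk : ∀ j < m, _ := fun j hj => kern (hmono j hj.le) (w := w) (w1 := w1)
    (fun s hs => hwd s (hsubx j hj hs)) (hw1c.mono (hsubx j hj)) (hw1m.mono (hsubx j hj))
    (hw1p _ (hlex j hj.le)) (I := I j) (J := J j) rfl rfl
  -- coefficients
  have ha : ∀ j < m, aco α t (m + 1) (j + 1) = 1 / (t (j + 1) - t j) * I j := by
    intro j hj
    rw [aco, if_neg (by omega)]
    simp only [Nat.add_sub_cancel]
    rfl
  have hb : ∀ j, bco α t (m + 1) (j + 1) = 
      2 / ((t (j + 1) - t j) * ((t (j + 1) - t j) + (t (j + 2) - t (j + 1)))) * J j := by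
    intro j
    rw [bco]
    simp only [Nat.add_sub_cancel]
    rfl
  have hr0 : rhok t 0 = 0 := by simp [rhok]
  have hr : ∀ j, rhok t (j + 1) = (t (j + 1) - t j) / (t (j + 2) - t (j + 1)) := by
    intro j; simp [rhok]
  have hAn : AK α t (m + 1) (m + 1) = aco α t (m + 1) (m + 1) + rhok t m * bco α t (m + 1) m := by
    rw [AK]
    by_cases h1 : m + 1 ≤ 1
    · have : m = 0 := by omega
      subst this
      simp [hr0]
    · rw [if_neg h1, if_pos rfl]; simp
  have hAk : ∀ j < m, AK α t (m + 1) (j + 1) = aco α t (m + 1) (j + 1) + rhok t j * bco α t (m + 1) j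
      - bco α t (m + 1) (j + 1) := by
    intro j hj
    rw [AK, if_neg (by omega), if_neg (by omega)]
    split_ifs with h1
    · have : j = 0 := by omega
      subst this
      simp [hr0]
    · simp
  have hb0 : ∀ j < m, 0 ≤ bco α t (m + 1) (j + 1) := by
    intro j hj
    rw [hb]
    have h1 := hmono j hj.le
    have h2 := hmono (j + 1) (by omega)
    have := (hk j hj).1
    have h3 : 0 < t (j + 1) - t j := by linarith
    have h4 : 0 < t (j + 2) - t (j + 1) := by linarith
    positivity
  have hrp : ∀ j < m, 0 ≤ rhok t (j + 1) := by
    intro j hj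
    rw [hr]
    have h1 := hmono j hj.le
    have h2 := hmono (j + 1) (by omega)
    exact div_nonneg (by linarith) (by linarith)
  have hrb : ∀ j ≤ m, 0 ≤ rhok t j * bco α t (m + 1) j := by
    intro j hj
    rcases j with _ | j
    · simp [hr0]
    · exact mul_nonneg (hrp j (by omega)) (hb0 j (by omega))
  have han : aco α t (m + 1) (m + 1) = 1 / (t (m + 1) - t m) * ∫ s in (t m)..x, w s := by
    rw [aco, if_pos rfl]
    simp only [Nat.add_sub_cancel]
    rfl
  have hwI : ∫ s in (t m)..x, w s = (∫ s in (t m)..x, (x - s) ^ (-α)) / G := by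
    simp only [hw]; rw [intervalIntegral.integral_div]
  have hanw : w (t m) ≤ aco α t (m + 1) (m + 1) := by
    rw [han, hwI, wint (by linarith)]
    have e : (x - t m) ^ (-α + 1) = (x - t m) ^ (-α) * (x - t m) := Real.rpow_add_one (by linarith) _
    have e2 : x - t m = (1 - α / 2) * (t (m + 1) - t m) := by rw [hx]; ring
    rw [e]
    have hp : 0 ≤ (x - t m) ^ (-α) := Real.rpow_nonneg (by linarith) _
    have h0 : 0 < t (m + 1) - t m := by linarith
    have h1 : 0 < -α + 1 := by linarith
    have e3 : 1 / (t (m + 1) - t m) * ((x - t m) ^ (-α) * (x - t m) / (-α + 1) / G) =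
        ((x - t m) ^ (-α) / G) * ((1 - α / 2) / (-α + 1)) := by
      nth_rewrite 2 [e2]
      field_simp
    rw [e3]
    have : 1 ≤ (1 - α / 2) / (-α + 1) := by rw [le_div_iff₀ h1]; linarith
    exact le_mul_of_one_le_right (by positivity) this
  have hup : ∀ j < m, w (t (j + 1)) + rhok t (j + 1) * bco α t (m + 1) (j + 1) ≤ AK α t (m + 1) (j + 1 + 1) := by
    intro j hj
    rcases Nat.lt_or_ge (j + 1) m with h | h
    · rw [hAk (j + 1) h, ha (j + 1) h, hb (j + 1)]
      have k := hk (j + 1) h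
      have h1 := hmono (j + 1) (by omega)
      have h2 := hmono (j + 2) (by omega)
      have := num1 (h := t (j + 1 + 1) - t (j + 1)) (h' := t (j + 1 + 2) - t (j + 1 + 1)) (by linarith) 
        (by have : t (j + 2) < t (j + 1 + 2) := h2
            have e : t (j + 2) = t (j + 1 + 1) := rfl
            linarith) k.1 k.2.2.2.2
      linarith
    · have : j + 1 = m := by omega
      subst this
      rw [hAn]
      linarith
  have hlow : ∀ j < m, rhok t j * bco α t (m + 1) j ≤ 4 / 5 * (w (t (j + 1)) - aco α t (m + 1) (j + 1)) := by
    intro j hj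
    have k := hk j hj
    have h1 := hmono j hj.le
    rw [ha j hj]
    rcases j with _ | j
    · rw [hr0, zero_mul]
      have h3 : 0 < t (0 + 1) - t 0 := by linarith
      have h4 : 0 ≤ (t (0 + 1) - t 0) * w (t (0 + 1)) - I 0 := 
        le_trans (by have := hw1p _ (hlex 0 (by omega)); positivity) k.2.2.1
      have h5 : w (t (0 + 1)) - 1 / (t (0 + 1) - t 0) * I 0 = 
        ((t (0 + 1) - t 0) * w (t (0 + 1)) - I 0) / (t (0 + 1) - t 0) := by field_simp
      rw [h5]
      positivity
    · have k' := hk j (by omega)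
      have h2 := hmono j (by omega)
      have hρj := hρ j (by omega)
      rw [hr] at hρj
      rw [hr, hb]
      exact num2 (by linarith) (by linarith) hρj (hw1p _ (hlex (j + 1) (by omega))) k'.2.1 k.2.2.1
  set Lk : ℕ → ℝ := fun j => (∫ s in (t j)..(t (j + 1)), w s * p s) - 
      aco α t (m + 1) (j + 1) * (v (t (j + 1)) - v (t j)) -
      bco α t (m + 1) (j + 1) * (rhok t (j + 1) * (v (t (j + 2)) - v (t (j + 1))) - (v (t (j + 1)) - v (t j))) with hLk
  have hhist : ∀ j < m, |Lk j| ≤ 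
      (AK α t (m + 1) (j + 1 + 1) - AK α t (m + 1) (j + 1)) * Ghis z t (j + 1) := by
    intro j hj
    have h1 := hmono j hj.le
    have h2 : t (j + 1) < t (j + 2) := hmono (j + 1) (by omega)
    have h3 : 0 < t (j + 1) - t j := by linarith
    have h4 : 0 < t (j + 2) - t (j + 1) := by linarith
    have k := hk j hj
    have u := hup j hj
    have l := hlow j hj
    have hA := hAk j hj
    have haj := ha j hj
    have hbj := hb0 j hj
    have hrj := mul_nonneg (hrp j hj) hbj
    have hF : 0 ≤ w (t (j + 1)) - aco α t (m + 1) (j + 1) := by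
      have := hrb j hj.le
      linarith
    have hEF : aco α t (m + 1) (j + 1) - w (t j) ≤ w (t (j + 1)) - aco α t (m + 1) (j + 1) := by
      have := div_le_div_of_nonneg_right k.2.2.2.1 h3.le
      rw [haj]
      have e1 : (I j - (t (j + 1) - t j) * w (t j)) / (t (j + 1) - t j) = 1 / (t (j + 1) - t j) * I j - w (t j) := by
        field_simp
      have e2 : ((t (j + 1) - t j) * w (t (j + 1)) - I j) / (t (j + 1) - t j) = 
          w (t (j + 1)) - 1 / (t (j + 1) - t j) * I j := by
        field_simp
      linarith
    have haj' : aco α t (m + 1) (j + 1) = I j / (t (j + 1) - t j) := by rw [haj]; ring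
    have hbbj : bco α t (m + 1) (j + 1) * ((t (j + 1) - t j) * (t (j + 2) - t j)) = 2 * J j := by
      rw [hb]
      have : t (j + 1) - t j + (t (j + 2) - t (j + 1)) = t (j + 2) - t j := by ring
      rw [this]
      have : 0 < t (j + 2) - t j := by linarith
      field_simp
    have hx1 := hsubx j hj
    have mA : t j ∈ Iio x := hlex j hj.le
    have mB : t (j + 1) ∈ Iio x := hlex (j + 1) (by omega)
    have key := H.hist (htnn j (by omega)) h1 h2 ((hle (j + 2) (m + 1) (by omega) le_rfl).trans hT)
      (w := w) (fun s hs => (hwd s (hx1 hs)).continuousAt.continuousWithinAt) (hwp _ mA)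
      (fun s hs => hwm mA (hx1 hs) hs.1) (fun s hs => hwm (hx1 hs) mB hs.2)
      (I := I j) (J := J j) (bb := bco α t (m + 1) (j + 1)) 
      (D := AK α t (m + 1) (j + 1 + 1) - AK α t (m + 1) (j + 1)) rfl rfl hbbj hbj
      (by rw [← haj']; linarith) (by rw [← haj']; linarith) (by rw [← hr]; linarith)
    rw [← haj', ← hr] at key
    have eG : Ghis z t (j + 1) = 5/2 * (∫ s in (t j)..(t (j + 1)), (s - t j) ^ 2 * |z s|) + 
        5/2 * ∫ s in (t (j + 1))..(t (j + 2)), (t (j + 2) - s) ^ 2 * |z s| := by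
      rw [Ghis]; simp only [Nat.add_sub_cancel]
    rw [eG]
    exact key
  set Ln : ℝ := (∫ s in (t m)..x, w s * p s) - aco α t (m + 1) (m + 1) * (v (t (m + 1)) - v (t m)) with hLn
  have hGl : Gloc z t (m + 1) = 3 / 2 * (∫ s in (t m)..((t m + t (m + 1)) / 2), (s - t m) ^ 2 * |z s|) +
        3 * (t (m + 1) - t m) / 2 * ∫ s in ((t m + t (m + 1)) / 2)..(t (m + 1)), (t (m + 1) - s) * |z s| := by
    rw [Gloc]; simp only [Nat.add_sub_cancel]
  have hGl0 : 0 ≤ Gloc z t (m + 1) := by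
    rw [hGl]
    have i1 : 0 ≤ ∫ s in (t m)..((t m + t (m + 1)) / 2), (s - t m) ^ 2 * |z s| :=
      intervalIntegral.integral_nonneg (by linarith) fun s _ => by positivity
    have i2 : 0 ≤ ∫ s in ((t m + t (m + 1)) / 2)..(t (m + 1)), (t (m + 1) - s) * |z s| :=
      intervalIntegral.integral_nonneg (by linarith) fun s hs => 
        mul_nonneg (by linarith [hs.2]) (abs_nonneg _)
    have : 0 < t (m + 1) - t m := by linarith
    positivity
  have hloc : |Ln| ≤ AK α t (m + 1) (m + 1) * Gloc z t (m + 1) := by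
    have key := H.loc hα0 hα1 (htnn m (by omega)) hmm hT hx rfl
    rw [← hGl] at key
    have eA : aco α t (m + 1) (m + 1) = (1 / (t (m + 1) - t m) * ∫ s in (t m)..x, (x - s) ^ (-α)) / G := by
      rw [han, hwI]; ring
    have eL : Ln = ((∫ s in (t m)..x, (x - s) ^ (-α) * p s) - 
        (1 / (t (m + 1) - t m) * ∫ s in (t m)..x, (x - s) ^ (-α)) * (v (t (m + 1)) - v (t m))) / G := by
      rw [hLn, eA]
      have : ∫ s in (t m)..x, w s * p s = (∫ s in (t m)..x, (x - s) ^ (-α) * p s) / G := by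
        rw [← intervalIntegral.integral_div]
        congr 1; ext s; simp only [hw]; ring
      rw [this]; ring
    have h1 : |Ln| ≤ aco α t (m + 1) (m + 1) * Gloc z t (m + 1) := by
      rw [eL, abs_div, abs_of_pos hG, eA]
      refine (div_le_div_of_nonneg_right key hG.le).trans (le_of_eq ?_)
      ring
    refine h1.trans (mul_le_mul_of_nonneg_right ?_ hGl0)
    rw [hAn]
    linarith [hrb m le_rfl]
  -- decomposition of the Caputo derivative
  have hint : ∀ j < m, IntervalIntegrable (fun s => w s * p s) volume (t j) (t (j + 1)) := by
    intro j hj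
    refine (H.intP (htnn j (by omega)) (hmono j hj.le).le 
      ((hle (j + 1) (m + 1) (by omega) le_rfl).trans hT)).continuousOn_mul ?_
    rw [uIcc_of_le (hmono j hj.le).le]
    exact fun s hs => (hwd s (hsubx j hj hs)).continuousAt.continuousWithinAt
  have hintn : IntervalIntegrable (fun s => w s * p s) volume (t m) x := by
    have hwi : ∀ y y', IntervalIntegrable w volume y y' := fun y y' => 
      (wii (α := -α) (by linarith)).div_const G
    set c := (t m + x) / 2 with hc
    have h0 := htnn m (by omega)
    have hc1 : t m < c := by rw [hc]; linarith
    have hc2 : c < x := by rw [hc]; linarith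
    refine IntervalIntegrable.trans (b := c) ?_ ?_
    · refine (H.intP h0 hc1.le (by linarith)).continuousOn_mul ?_
      rw [uIcc_of_le hc1.le]
      exact fun s hs => (hwd s (by linarith [hs.2])).continuousAt.continuousWithinAt
    · refine (hwi c x).mul_continuousOn ?_
      rw [uIcc_of_le hc2.le]
      exact H.contP.mono fun s hs => ⟨by linarith [hs.1], by linarith [hs.2]⟩
  have hcap : caputo α p x = (∑ i ∈ Finset.range m, ∫ s in (t i)..(t (i + 1)), w s * p s) + 
      ∫ s in (t m)..x, w s * p s := by
    rw [sum_integral_adjacent_intervals hint, ht0, integral_add_adjacent_intervals _ hintn]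
    · rfl
    · rw [← ht0]
      exact IntervalIntegrable.trans_iterate hint
  have hsum : ∑ i ∈ Finset.range (m + 1), AK α t (m + 1) (i + 1) * (v (t (i + 1)) - v (t i)) =
      (∑ i ∈ Finset.range m, (aco α t (m + 1) (i + 1) * (v (t (i + 1)) - v (t i)) +
      bco α t (m + 1) (i + 1) * (rhok t (i + 1) * (v (t (i + 2)) - v (t (i + 1))) - (v (t (i + 1)) - v (t i))))) +
      aco α t (m + 1) (m + 1) * (v (t (m + 1)) - v (t m)) := by
    have s1 : ∑ i ∈ Finset.range m, rhok t (i + 1) * bco α t (m + 1) (i + 1) * (v (t (i + 2)) - v (t (i + 1))) =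
        ∑ i ∈ Finset.range (m + 1), rhok t i * bco α t (m + 1) i * (v (t (i + 1)) - v (t i)) := by
      rw [Finset.sum_range_succ', hr0]; simp
    rw [Finset.sum_range_succ] at s1
    have s2 : ∑ i ∈ Finset.range m, AK α t (m + 1) (i + 1) * (v (t (i + 1)) - v (t i)) = 
        ∑ i ∈ Finset.range m, ((aco α t (m + 1) (i + 1) - bco α t (m + 1) (i + 1)) * (v (t (i + 1)) - v (t i)) +
          rhok t i * bco α t (m + 1) i * (v (t (i + 1)) - v (t i))) := by
      refine Finset.sum_congr rfl fun i hi => ?_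
      rw [hAk i (Finset.mem_range.1 hi)]; ring
    have s3 : ∑ i ∈ Finset.range m, (aco α t (m + 1) (i + 1) * (v (t (i + 1)) - v (t i)) +
      bco α t (m + 1) (i + 1) * (rhok t (i + 1) * (v (t (i + 2)) - v (t (i + 1))) - (v (t (i + 1)) - v (t i)))) =
      ∑ i ∈ Finset.range m, ((aco α t (m + 1) (i + 1) - bco α t (m + 1) (i + 1)) * (v (t (i + 1)) - v (t i)) +
        rhok t (i + 1) * bco α t (m + 1) (i + 1) * (v (t (i + 2)) - v (t (i + 1)))) := by
      refine Finset.sum_congr rfl fun i hi => ?_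
      ring
    rw [Finset.sum_range_succ, s2, s3, Finset.sum_add_distrib, Finset.sum_add_distrib, s1, hAn]
    ring
  have hdec : caputo α p x - ∑ i ∈ Finset.range (m + 1), AK α t (m + 1) (i + 1) * (v (t (i + 1)) - v (t i)) =
      Ln + ∑ i ∈ Finset.range m, Lk i := by
    have : ∑ i ∈ Finset.range m, Lk i = (∑ i ∈ Finset.range m, ∫ s in (t i)..(t (i + 1)), w s * p s) -
      ∑ i ∈ Finset.range m, (aco α t (m + 1) (i + 1) * (v (t (i + 1)) - v (t i)) +
      bco α t (m + 1) (i + 1) * (rhok t (i + 1) * (v (t (i + 2)) - v (t (i + 1))) - (v (t (i + 1)) - v (t i)))) := by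
      rw [← Finset.sum_sub_distrib]
      refine Finset.sum_congr rfl fun i hi => ?_
      simp only [hLk]; ring
    rw [hcap, hsum, this, hLn]
    ring
  rw [hdec]
  refine (abs_add_le _ _).trans (add_le_add hloc ?_)
  refine (Finset.abs_sum_le_sum_abs _ _).trans (Finset.sum_le_sum fun i hi => ?_)
  exact hhist i (Finset.mem_range.1 hi)
end

theorem stmt_17 (α σ T Cv : ℝ) (hα0 : 0 < α) (hα1 : α < 1)
    (hσ : (0 < σ ∧ σ < 1) ∨ (1 < σ ∧ σ < 2)) (hT : 0 < T) (hCv : 0 < Cv)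
    (v v' v'' v''' : ℝ → ℝ)
    (hvc : ContinuousOn v (Set.Icc 0 T))
    (hd1 : ∀ s ∈ Set.Ioc (0:ℝ) T, HasDerivAt v (v' s) s)
    (hd2 : ∀ s ∈ Set.Ioc (0:ℝ) T, HasDerivAt v' (v'' s) s)
    (hd3 : ∀ s ∈ Set.Ioc (0:ℝ) T, HasDerivAt v'' (v''' s) s)
    (hb1 : ∀ s ∈ Set.Ioc (0:ℝ) T, |v' s| ≤ Cv * (1 + s ^ (σ - 1)))
    (hb2 : ∀ s ∈ Set.Ioc (0:ℝ) T, |v'' s| ≤ Cv * (1 + s ^ (σ - 2)))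
    (hb3 : ∀ s ∈ Set.Ioc (0:ℝ) T, |v''' s| ≤ Cv * (1 + s ^ (σ - 3)))
    (N : ℕ) (hN : 1 ≤ N) (t : ℕ → ℝ) (ht0 : t 0 = 0) (htN : t N = T)
    (htmono : ∀ k : ℕ, 1 ≤ k → k ≤ N → t (k-1) < t k)
    (hρ : ∀ k : ℕ, 1 ≤ k → k ≤ N - 1 → rhok t k ≤ 7/4)
    (n : ℕ) (hn1 : 1 ≤ n) (hnN : n ≤ N) :
    |caputo α v' (tw (α/2) t n)
        - ∑ k ∈ Finset.Icc 1 n, AK α t n k * (v (t k) - v (t (k-1)))|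
      ≤ AK α t n n * Gloc v''' t n
        + ∑ k ∈ Finset.Icc 1 (n-1), (AK α t n (k+1) - AK α t n k) * Ghis v''' t k := by
  obtain ⟨C, β, H⟩ := mkReg σ T Cv hσ hT hCv v v' v'' v''' hvc hd1 hd2 hd3 hb1 hb2 hb3
  obtain ⟨m, rfl⟩ : ∃ m, n = m + 1 := ⟨n - 1, by omega⟩
  have hmono : ∀ j < N, t j < t (j + 1) := fun j hj => by
    have := htmono (j + 1) (by omega) (by omega)
    simpa using this
  have hle : ∀ j, m + 1 ≤ j → j ≤ N → t (m + 1) ≤ t j := by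
    intro j hij
    induction j, hij using Nat.le_induction with
    | base => intro _; exact le_rfl
    | succ j hj ih => intro hjm; exact (ih (by omega)).trans (hmono j (by omega)).le
  have key := final_aux H hα0 hα1 t m ht0 (fun j hj => hmono j (by omega))
    (by rw [← htN]; exact hle N hnN le_rfl) (fun j hj => hρ (j + 1) (by omega) (by omega))
  rw [sum_Icc_shift, sum_Icc_shift]
  simp only [Nat.add_sub_cancel]
  exact key
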